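/- arXiv:2208.00073 — 2 statements merged into one kernel-verified Lean document; each statement's English description precedes it below -/
import Mathlib

section
/- Geometric form of Proposition 5.2: For every integer n ≥ 4 and every sign function ε : {2, …, n} → {+1, −1}, there exists a stable 2(n−1)-gon of type D_n, with vertices V₁, …, V_{2(n−1)} and punctures B₋ = −B₊, with the following property. List the 2n points {V_j} ∪ {B₊, B₋} in increasing order as Y_{−n} ≤ Y_{−n+1} ≤ ⋯ ≤ Y_{−1} ≤ Y₁ ≤ ⋯ ≤ Y_n (so Y_{−i} = −Y_i and B₋ ∈ {Y_{−1}, Y_{−2}}); set s_i := Y_{i−n} − Y_{i−n−1} for 1 ≤ i ≤ n−1, and set s_n := B₊ − Y_{−2} if B₋ = Y_{−1} and s_n := B₊ − Y_{−1} if B₋ = Y_{−2}. Then for every 2 ≤ i ≤ n−1 the number Im( conj(s_{i−1}) · s_i ) is nonzero with sign ε(i), and Im( conj(s_{n−2}) · s_n ) is nonzero with sign ε(n). (This realizes every orientation of the type D_n diagram as the intersection quiver of a stable 2(n−1)-gon of type D_n.) -/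
noncomputable section

/-- The (strict) total order on `ℂ`: compare imaginary parts first, then real parts. -/
def cLt (a b : ℂ) : Prop := a.im < b.im ∨ (a.im = b.im ∧ a.re < b.re)

/-- The corresponding non-strict order on `ℂ`. -/
def cLe (a b : ℂ) : Prop := cLt a b ∨ a = b

/-- `cross u v = Im (conj u * v)`. -/
def cross (u v : ℂ) : ℝ := ((starRingEnd ℂ) u * v).im

/-- A positively convex `h`-gon: every other vertex lies strictly to the left of each
directed edge from `V (j-1)` to `V j`. -/
def PosConvex {h : ℕ} (V : ZMod h → ℂ) : Prop :=
  ∀ j i : ZMod h, i ≠ j - 1 → i ≠ j →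
    0 < cross (V j - V (j - 1)) (V i - V (j - 1))

/-- The (open) level-`s` diagonal-gon of an `h`-gon. -/
def DiagGon {h : ℕ} (V : ZMod h → ℂ) (s : ℕ) : Set ℂ :=
  {P : ℂ | ∀ j : ZMod h, 0 < cross (V (j + (s : ZMod h)) - V j) (P - V j)}

/-- Edge vectors of an `h`-gon. -/
def zEdge {h : ℕ} (V : ZMod h → ℂ) (j : ZMod h) : ℂ := V j - V (j - 1)

/-- Central symmetry about `0` for a `2(n-1)`-gon. -/
def DSym (n : ℕ) (V : ZMod (2 * (n - 1)) → ℂ) : Prop :=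
  ∀ j : ZMod (2 * (n - 1)), V (j + ((n - 1 : ℕ) : ZMod (2 * (n - 1)))) = -V j

/-- A stable `2(n-1)`-gon of type `D_n`, with punctures `B₊ = B` and `B₋ = -B`. -/
def IsStableDGon (n : ℕ) (V : ZMod (2 * (n - 1)) → ℂ) (B : ℂ) : Prop :=
  PosConvex V ∧ DSym n V ∧ cLe (-B) B ∧
    (-B) ∈ DiagGon V (n - 2) ∧ B ∈ DiagGon V (n - 2)

/-- The `2n` marked points of a type `D_n` gon: the vertices together with the two punctures. -/
def DPoints (n : ℕ) (V : ZMod (2 * (n - 1)) → ℂ) (B : ℂ) :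
    ZMod (2 * (n - 1)) ⊕ Fin 2 → ℂ :=
  Sum.elim V (fun b => if b = 0 then B else -B)

/-- `Y 0, Y 1, …, Y (2n-1)` is an increasing enumeration (via the bijection `e`) of the
`2n` marked points; `Y i` corresponds to the point `Y_{i-n}` (for `0 ≤ i ≤ n-1`) resp.
`Y_{i-n+1}` (for `n ≤ i ≤ 2n-1`) of the paper. -/
def DEnum (n : ℕ) (V : ZMod (2 * (n - 1)) → ℂ) (B : ℂ) (Y : ℕ → ℂ)
    (e : Fin (2 * n) ≃ (ZMod (2 * (n - 1)) ⊕ Fin 2)) : Prop :=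
  (∀ m : Fin (2 * n), Y (m : ℕ) = DPoints n V B (e m)) ∧
  (∀ i j : ℕ, i < j → j < 2 * n → cLe (Y i) (Y j))


def circ (t : ℝ) : ℂ := ⟨Real.sin t, -Real.cos t⟩

lemma cross_eq (u v : ℂ) : cross u v = u.re * v.im - u.im * v.re := by
  simp [cross, Complex.mul_im]; ring

lemma circ_re (t : ℝ) : (circ t).re = Real.sin t := rfl
lemma circ_im (t : ℝ) : (circ t).im = -Real.cos t := rfl

lemma circ_cross (a b : ℝ) : cross (circ a) (circ b) = Real.sin (b - a) := by
  rw [cross_eq, circ_re, circ_re, circ_im, circ_im, Real.sin_sub]; ring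

lemma circ_add_pi (t : ℝ) : circ (t + Real.pi) = - circ t := by
  apply Complex.ext <;> simp [circ]

lemma circ_add_int (t : ℝ) (k : ℤ) : circ (t + k * (2 * Real.pi)) = circ t := by
  apply Complex.ext <;> simp [circ]

lemma circ_tri (a b c : ℝ) : cross (circ b - circ a) (circ c - circ a) =
    4 * Real.sin ((b - a) / 2) * Real.sin ((c - b) / 2) * Real.sin ((c - a) / 2) := by
  obtain ⟨u, rfl⟩ : ∃ u, b = a + 2 * u := ⟨(b - a) / 2, by ring⟩
  obtain ⟨v, rfl⟩ : ∃ v, c = a + 2 * u + 2 * v := ⟨(c - (a + 2 * u)) / 2, by ring⟩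
  have e1 : (a + 2 * u - a) / 2 = u := by ring
  have e2 : (a + 2 * u + 2 * v - (a + 2 * u)) / 2 = v := by ring
  have e3 : (a + 2 * u + 2 * v - a) / 2 = u + v := by ring
  rw [e1, e2, e3]
  have key : cross (circ (a + 2 * u) - circ a) (circ (a + 2 * u + 2 * v) - circ a) =
      Real.sin (2 * v) - Real.sin (2 * u + 2 * v) + Real.sin (2 * u) := by
    have h1 := circ_cross (a + 2 * u) (a + 2 * u + 2 * v)
    have h2 := circ_cross a (a + 2 * u + 2 * v)
    have h3 := circ_cross a (a + 2 * u)
    rw [show a + 2 * u + 2 * v - (a + 2 * u) = 2 * v by ring] at h1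
    rw [show a + 2 * u + 2 * v - a = 2 * u + 2 * v by ring] at h2
    rw [show a + 2 * u - a = 2 * u by ring] at h3
    rw [← h1, ← h2, ← h3]
    simp only [cross_eq, Complex.sub_re, Complex.sub_im]; ring
  rw [key, Real.sin_add (2 * u), Real.sin_add u, Real.sin_two_mul, Real.sin_two_mul,
    Real.cos_two_mul, Real.cos_two_mul]
  have hu := Real.sin_sq_add_cos_sq u
  have hv := Real.sin_sq_add_cos_sq v
  have hu' : Real.cos u ^ 2 = 1 - Real.sin u ^ 2 := by linarith
  have hv' : Real.cos v ^ 2 = 1 - Real.sin v ^ 2 := by linarith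
  rw [hu', hv']; ring

lemma sin_ge (g t : ℝ) (hg : 0 < g) (h1 : g ≤ t) (h2 : t ≤ Real.pi - g) :
    Real.sin g ≤ Real.sin t := by
  rcases le_total t (Real.pi / 2) with h | h
  · exact Real.sin_le_sin_of_le_of_le_pi_div_two (by linarith [Real.pi_pos]) h h1
  · rw [← Real.sin_pi_sub t]
    exact Real.sin_le_sin_of_le_of_le_pi_div_two (by linarith [Real.pi_pos]) (by linarith)
      (by linarith)

lemma sort_exists (m : ℕ) (hm : 2 ≤ m) (θ : Fin m → ℝ) (g : ℝ) (hg : 0 < g)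
    (hsep : ∀ j k, j ≠ k → g ≤ |θ j - θ k| ∧ |θ j - θ k| ≤ Real.pi - g) :
    ∃ (F : ℕ → ℝ) (τ : Equiv.Perm (Fin m)), (∀ r : Fin m, F r = θ (τ r)) ∧
      ∀ r s, r < s → s < m → g ≤ F s - F r ∧ F s - F r ≤ Real.pi - g := by
  refine ⟨fun r => if h : r < m then θ (Tuple.sort θ ⟨r, h⟩) else 0, Tuple.sort θ, ?_, ?_⟩
  · intro r; simp
  · intro r s hrs hs
    have hr : r < m := by omega
    simp only [hs, hr, dif_pos]
    have hmono := Tuple.monotone_sort θ (show (⟨r, hr⟩ : Fin m) ≤ ⟨s, hs⟩ from hrs.le)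
    have := hsep (Tuple.sort θ ⟨s, hs⟩) (Tuple.sort θ ⟨r, hr⟩) (by
      intro h; have := (Tuple.sort θ).injective h; simp at this; omega)
    simp only [Function.comp] at hmono
    rwa [abs_of_nonneg (by linarith)] at this

lemma gon_exists (m : ℕ) (hm : 2 ≤ m) (θ : Fin m → ℝ) (g : ℝ) (hg : 0 < g)
    (hsep : ∀ j k, j ≠ k → g ≤ |θ j - θ k| ∧ |θ j - θ k| ≤ Real.pi - g) :
    ∃ (V : ZMod (2 * m) → ℂ) (idx : Fin m → ZMod (2 * m)),
      PosConvex V ∧ (∀ z, V (z + (m : ZMod (2 * m))) = - V z) ∧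
      (∀ k, V (idx k) = circ (θ k)) ∧
      (∀ z, ∃ k, z = idx k ∨ z = idx k + (m : ZMod (2 * m))) ∧
      (∀ z, Real.sin g ≤ cross (V (z - 1)) (V z)) ∧
      (∀ z, |(V z).re| ≤ 1) := by
  obtain ⟨F, τ, hF, hFs⟩ := sort_exists m hm θ g hg hsep
  have hm0 : (0 : ℤ) < m := by omega
  have : NeZero (2 * m) := ⟨by omega⟩
  set Θ : ℤ → ℝ := fun k => F (k % m).toNat + Real.pi * ((k / m : ℤ) : ℝ) with hΘ
  have hΘm : ∀ k : ℤ, Θ (k + m) = Θ k + Real.pi := by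
    intro k
    simp only [hΘ, Int.add_emod_right, Int.add_ediv_of_dvd_right (dvd_refl (m : ℤ)),
      Int.ediv_self hm0.ne']
    push_cast; ring
  have hstep : ∀ k : ℤ, g ≤ Θ (k + 1) - Θ k ∧ Θ (k + 1) - Θ k ≤ Real.pi - g := by
    intro k
    have h0 := Int.emod_nonneg k hm0.ne'
    have h1 := Int.emod_lt_of_pos k hm0
    have h2 := Int.emod_add_mul_ediv k m
    by_cases hc : k % m + 1 < m
    · have e1 : (k + 1) % m = k % m + 1 := by
        rw [Int.add_emod, Int.emod_eq_of_lt (a := 1) (by omega) (by omega)]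
        exact Int.emod_eq_of_lt (by omega) hc
      have e2 : (k + 1) / m = k / m := by
        have h3 := Int.emod_add_mul_ediv (k + 1) m
        have : (m : ℤ) * ((k + 1) / m) = m * (k / m) := by omega
        exact mul_left_cancel₀ hm0.ne' this
      have := hFs (k % m).toNat (k % m + 1).toNat (by omega) (by omega)
      simp only [hΘ, e1, e2]
      constructor <;> linarith
    · have e0 : k % m = m - 1 := by omega
      have e1 : (k + 1) % m = 0 := by
        rw [show k + 1 = m * (k / m + 1) by rw [mul_add]; omega]; simp
      have e2 : (k + 1) / m = k / m + 1 := by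
        rw [show k + 1 = m * (k / m + 1) by rw [mul_add]; omega]
        rw [Int.mul_ediv_cancel_left _ hm0.ne']
      have := hFs 0 (m - 1 : ℤ).toNat (by omega) (by omega)
      simp only [hΘ, e0, e1, e2]
      push_cast
      constructor <;> linarith
  have hmono : StrictMono Θ := strictMono_int_of_lt_succ (fun k => by linarith [(hstep k).1])
  have hΘ2 : ∀ (k t : ℤ), Θ (k + t * (2 * m)) = Θ k + t * (2 * Real.pi) := by
    intro k t
    have e1 : (k + t * (2 * m)) % m = k % m := by
      rw [show k + t * (2 * m) = k + m * (t * 2) by ring]; simp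
    have e2 : (k + t * (2 * m)) / m = k / m + t * 2 := by
      rw [show k + t * (2 * m) = k + m * (t * 2) by ring]
      rw [Int.add_mul_ediv_left _ _ hm0.ne']
    simp only [hΘ, e1, e2]; push_cast; ring
  set V : ZMod (2 * m) → ℂ := fun z => circ (Θ (z.val : ℤ)) with hV
  have hVc : ∀ k : ℤ, V (k : ZMod (2 * m)) = circ (Θ k) := by
    intro k
    simp only [hV, ZMod.val_intCast]
    have h2 := Int.emod_add_mul_ediv k ((2 * m : ℕ) : ℤ)
    have := hΘ2 (k % ((2 * m : ℕ) : ℤ)) (k / ((2 * m : ℕ) : ℤ))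
    rw [show k % ((2 * m : ℕ) : ℤ) + k / ((2 * m : ℕ) : ℤ) * (2 * m) = k by
      conv_rhs => rw [← h2]
      push_cast; ring] at this
    rw [this, circ_add_int]
  have hlift : ∀ z : ZMod (2 * m), ∃ k : ℤ, (k : ZMod (2 * m)) = z := ZMod.intCast_surjective
  refine ⟨V, fun k => (((τ.symm k : Fin m) : ℕ) : ZMod (2 * m)), ?_, ?_, ?_, ?_, ?_, ?_⟩
  · intro j i hi1 hi2
    obtain ⟨k, rfl⟩ := hlift j
    obtain ⟨l, hl1, hl2, rfl⟩ : ∃ l : ℤ, k ≤ l ∧ l < k + 2 * m ∧ (l : ZMod (2 * m)) = i := by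
      obtain ⟨l, rfl⟩ := hlift i
      refine ⟨k + (l - k) % ((2 * m : ℕ) : ℤ), ?_, ?_, ?_⟩
      · have := Int.emod_nonneg (l - k) (show ((2 * m : ℕ) : ℤ) ≠ 0 by omega); omega
      · have := Int.emod_lt_of_pos (l - k) (show 0 < ((2 * m : ℕ) : ℤ) by omega); omega
      · push_cast [ZMod.intCast_mod]
        have := ZMod.intCast_mod (l - k) (2 * m)
        push_cast at this
        rw [this]; ring
    have hlk : l ≠ k := by rintro rfl; exact hi2 rfl
    have hlk' : l ≠ k - 1 + 2 * m := by
      rintro rfl; apply hi1; push_cast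
      have : ((2 * m : ℕ) : ZMod (2 * m)) = 0 := ZMod.natCast_self _
      push_cast at this
      rw [this]; ring
    have e : ((k : ZMod (2 * m)) - 1) = ((k - 1 : ℤ) : ZMod (2 * m)) := by push_cast; ring
    rw [e, hVc, hVc, hVc, circ_tri]
    have a1 := hmono (show k - 1 < k by omega)
    have a2 := hmono (show k < l by omega)
    have a3 := hmono (show l < (k - 1) + 1 * (2 * m) by omega)
    rw [hΘ2] at a3
    push_cast at a3
    have b1 : 0 < Real.sin ((Θ k - Θ (k - 1)) / 2) :=
      Real.sin_pos_of_pos_of_lt_pi (by linarith) (by linarith)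
    have b2 : 0 < Real.sin ((Θ l - Θ k) / 2) :=
      Real.sin_pos_of_pos_of_lt_pi (by linarith) (by linarith)
    have b3 : 0 < Real.sin ((Θ l - Θ (k - 1)) / 2) :=
      Real.sin_pos_of_pos_of_lt_pi (by linarith) (by linarith)
    positivity
  · intro z
    obtain ⟨k, rfl⟩ := hlift z
    have := hVc (k + m)
    rw [hΘm, circ_add_pi, ← hVc] at this
    rw [← this]; push_cast; rfl
  · intro k
    have := hVc ((τ.symm k : Fin m) : ℕ)
    rw [Int.cast_natCast] at this
    simp only []
    rw [this]
    congr 1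
    have hlt := (τ.symm k).isLt
    have e1 : (((τ.symm k : Fin m) : ℕ) : ℤ) % m = ((τ.symm k : Fin m) : ℕ) :=
      Int.emod_eq_of_lt (by omega) (by omega)
    have e2 : (((τ.symm k : Fin m) : ℕ) : ℤ) / m = 0 :=
      Int.ediv_eq_zero_of_lt (by omega) (by omega)
    simp only [hΘ, e1, e2, Int.toNat_natCast, hF]
    simp
  · intro z
    have hz : ((z.val : ℕ) : ZMod (2 * m)) = z := ZMod.natCast_zmod_val z
    have hlt := ZMod.val_lt z
    by_cases h : z.val < m
    · refine ⟨τ ⟨z.val, h⟩, Or.inl ?_⟩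
      simp
    · refine ⟨τ ⟨z.val - m, by omega⟩, Or.inr ?_⟩
      simp only [Equiv.symm_apply_apply]
      rw [← Nat.cast_add, Nat.sub_add_cancel (by omega), hz]
  · intro z
    obtain ⟨k, rfl⟩ := hlift z
    have e : ((k : ZMod (2 * m)) - 1) = ((k - 1 : ℤ) : ZMod (2 * m)) := by push_cast; ring
    rw [e, hVc, hVc, circ_cross]
    have := hstep (k - 1)
    rw [sub_add_cancel] at this
    exact sin_ge g _ hg this.1 this.2
  · intro z
    exact Real.abs_sin_le_one _

lemma angles_exist (m : ℕ) (hm : 3 ≤ m) : ∃ (a : ℕ → ℝ) (g δ : ℝ), 0 < g ∧ 0 < δ ∧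
    2 * δ < Real.sin g ∧ (∀ k, k < m → 0 ≤ a k ∧ a k < Real.pi / 2) ∧
    (∀ j k, j < k → k < m → a j + g ≤ a k ∧ a j + a k ≤ Real.pi - g) ∧
    Real.cos (a (m - 1)) < δ ∧ δ < Real.cos (a (m - 2)) := by
  have hm1 : (2 : ℝ) ≤ (m : ℝ) - 1 := by
    have : (3 : ℝ) ≤ m := by exact_mod_cast hm
    linarith
  obtain ⟨x, hx⟩ : ∃ x : ℝ, 4 * ((m : ℝ) - 1) * x = Real.pi / 2 :=
    ⟨Real.pi / 2 / (4 * ((m : ℝ) - 1)), by field_simp⟩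
  have hpi := Real.pi_pos
  have hpi4 := Real.pi_lt_four
  have hx0 : 0 < x := by
    by_contra h
    push Not at h
    nlinarith
  have hx1 : 8 * x ≤ Real.pi / 2 := by nlinarith
  have hs0 : 0 < Real.sin x := Real.sin_pos_of_pos_of_lt_pi hx0 (by linarith)
  have hs1 : Real.sin x ≤ 1 / 4 := by
    have := Real.sin_le hx0.le
    linarith
  have hs3 : 2 * Real.sin x < Real.sin (3 * x) := by
    rw [Real.sin_three_mul]
    nlinarith [mul_pos hs0 hs0, mul_pos hs0 (mul_pos hs0 hs0)]
  obtain ⟨δ, hd1, hd2⟩ := exists_between (show Real.sin x < Real.sin (3 * x) / 2 by linarith)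
  have hk : ∀ k : ℕ, k < m - 1 → 4 * (k : ℝ) * x ≤ Real.pi / 2 - 4 * x := by
    intro k hk
    have : (k : ℝ) + 1 ≤ (m : ℝ) - 1 := by
      have : k + 2 ≤ m := by omega
      have : (k : ℝ) + 2 ≤ m := by exact_mod_cast this
      linarith
    nlinarith
  refine ⟨fun k => if k < m - 1 then 4 * k * x else Real.pi / 2 - x, 3 * x, δ, by linarith,
    by linarith, by linarith, ?_, ?_, ?_, ?_⟩
  · intro k _
    by_cases h : k < m - 1
    · simp only [h, if_true]
      exact ⟨by positivity, by linarith [hk k h]⟩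
    · simp only [h, if_false]
      exact ⟨by linarith, by linarith⟩
  · intro j k hjk hkm
    have hj : j < m - 1 := by omega
    have hj' := hk j hj
    simp only [hj, if_true]
    by_cases h : k < m - 1
    · simp only [h, if_true]
      have := hk k h
      have : (j : ℝ) + 1 ≤ k := by exact_mod_cast hjk
      exact ⟨by nlinarith, by linarith⟩
    · simp only [h, if_false]
      exact ⟨by linarith, by linarith⟩
  · simp only [lt_irrefl, if_false]
    rw [Real.cos_pi_div_two_sub]; exact hd1
  · have h2 : m - 2 < m - 1 := by omega
    simp only [h2, if_true]
    have e : 4 * ((m - 2 : ℕ) : ℝ) * x = Real.pi / 2 - 4 * x := by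
      rw [Nat.cast_sub (by omega)]; push_cast; linarith
    rw [e, Real.cos_pi_div_two_sub]
    have : Real.sin (3 * x) < Real.sin (4 * x) :=
      Real.sin_lt_sin_of_lt_of_le_pi_div_two (by linarith) (by linarith) (by linarith)
    linarith

lemma enum_exists (m : ℕ) (hm : 3 ≤ m) (V : ZMod (2 * m) → ℂ) (idx : Fin m → ZMod (2 * m))
    (B : ℂ) (hsym : ∀ z, V (z + (m : ZMod (2 * m))) = - V z)
    (hsurj : ∀ z, ∃ k, z = idx k ∨ z = idx k + (m : ZMod (2 * m)))
    (P : ℕ → ℂ) (hP : ∀ k : Fin m, P k = V (idx k)) (hPB : P m = -B)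
    (ρ : ℕ → ℕ) (hρ : ∀ i, i < m + 1 → ρ i < m + 1 ∧ ρ (ρ i) = i)
    (hlow : ∀ i j, i < j → j < m + 1 → (P (ρ i)).im < (P (ρ j)).im)
    (hneg : ∀ i, i < m + 1 → (P (ρ i)).im < 0 ∨ P (ρ i) = 0) :
    ∃ e, DEnum (m + 1) V B
      (fun i => if i < m + 1 then P (ρ i) else - P (ρ (2 * m + 1 - i))) e := by
  have : NeZero (2 * m) := ⟨by omega⟩
  let E : ℕ → ZMod (2 * m) ⊕ Fin 2 := fun k =>
    if h : k < m then Sum.inl (idx ⟨k, h⟩) else Sum.inr 1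
  let E' : ℕ → ZMod (2 * m) ⊕ Fin 2 := fun k =>
    if h : k < m then Sum.inl (idx ⟨k, h⟩ + (m : ZMod (2 * m))) else Sum.inr 0
  let f : Fin (2 * (m + 1)) → ZMod (2 * m) ⊕ Fin 2 := fun i =>
    if (i : ℕ) < m + 1 then E (ρ i) else E' (ρ (2 * m + 1 - i))
  have hE : ∀ k, k < m + 1 → ∃ i, f i = E k := by
    intro k hk
    have h1 := (hρ k hk).1
    refine ⟨⟨ρ k, by omega⟩, ?_⟩
    simp only [f, h1, if_true, (hρ k hk).2]
  have hE' : ∀ k, k < m + 1 → ∃ i, f i = E' k := by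
    intro k hk
    have h1 := (hρ k hk).1
    refine ⟨⟨2 * m + 1 - ρ k, by omega⟩, ?_⟩
    have h2 : ¬ (2 * m + 1 - ρ k < m + 1) := by omega
    have h3 : 2 * m + 1 - (2 * m + 1 - ρ k) = ρ k := by omega
    simp only [f, h2, if_false, h3, (hρ k hk).2]
  have hfs : Function.Surjective f := by
    rintro (z | b)
    · obtain ⟨k, rfl | rfl⟩ := hsurj z
      · obtain ⟨i, hi⟩ := hE k (by omega)
        exact ⟨i, by rw [hi]; simp [E]⟩
      · obtain ⟨i, hi⟩ := hE' k (by omega)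
        exact ⟨i, by rw [hi]; simp [E']⟩
    · fin_cases b
      · obtain ⟨i, hi⟩ := hE' m (by omega)
        exact ⟨i, by rw [hi]; simp [E']⟩
      · obtain ⟨i, hi⟩ := hE m (by omega)
        exact ⟨i, by rw [hi]; simp [E]⟩
  have hfb : Function.Bijective f := by
    rw [Fintype.bijective_iff_surjective_and_card]
    refine ⟨hfs, ?_⟩
    simp [ZMod.card]; ring
  have hPE : ∀ k, k < m + 1 → P k = DPoints (m + 1) V B (E k) := by
    intro k hk
    by_cases h : k < m
    · simp only [E, h, dif_pos, DPoints]
      exact hP ⟨k, h⟩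
    · have : k = m := by omega
      subst this
      simp [E, DPoints, hPB]
  have hPE' : ∀ k, k < m + 1 → - P k = DPoints (m + 1) V B (E' k) := by
    intro k hk
    by_cases h : k < m
    · simp only [E', h, dif_pos, DPoints]
      rw [hP ⟨k, h⟩]
      exact (hsym _).symm
    · have : k = m := by omega
      subst this
      simp [E', DPoints, hPB]
  refine ⟨Equiv.ofBijective f hfb, ?_, ?_⟩
  · intro i
    have hi := i.isLt
    simp only [Equiv.ofBijective_apply, f]
    split_ifs with h
    · exact hPE _ (hρ _ h).1
    · exact hPE' _ (hρ _ (by omega)).1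
  · intro i j hij hj
    by_cases h1 : j < m + 1
    · have h2 : i < m + 1 := by omega
      simp only [h1, h2, if_true]
      exact Or.inl (Or.inl (hlow i j hij h1))
    · by_cases h2 : i < m + 1
      · simp only [h1, h2, if_true, if_false]
        rcases hneg i h2 with h | h <;> rcases hneg (2 * m + 1 - j) (by omega) with h' | h'
        · exact Or.inl (Or.inl (by rw [Complex.neg_im]; linarith))
        · exact Or.inl (Or.inl (by rw [h']; simpa using h))
        · exact Or.inl (Or.inl (by rw [h]; simpa using h'))
        · exact Or.inr (by rw [h, h']; simp)
      · simp only [h1, h2, if_false]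
        have := hlow (2 * m + 1 - j) (2 * m + 1 - i) (by omega) (by omega)
        exact Or.inl (Or.inl (by rw [Complex.neg_im, Complex.neg_im]; linarith))

lemma base_exists (m : ℕ) (hm : 3 ≤ m) (σ : ℕ → ℝ) (hσ : ∀ k, σ k = 1 ∨ σ k = -1) :
    ∃ (p : ℕ → ℂ) (s δ : ℝ) (V : ZMod (2 * m) → ℂ) (idx : Fin m → ZMod (2 * m)),
      0 < δ ∧ 2 * δ < s ∧
      PosConvex V ∧ (∀ z, V (z + (m : ZMod (2 * m))) = - V z) ∧
      (∀ k : Fin m, V (idx k) = p k) ∧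
      (∀ z, ∃ k, z = idx k ∨ z = idx k + (m : ZMod (2 * m))) ∧
      (∀ z, s ≤ cross (V (z - 1)) (V z)) ∧
      (∀ z, |(V z).re| ≤ 1) ∧
      (∀ k, |(p k).re| ≤ 1) ∧ (∀ k, k < m → (p k).im < 0) ∧
      (∀ j k, j < k → k < m → (p j).im < (p k).im) ∧
      -δ < (p (m - 1)).im ∧ (p (m - 2)).im < -δ ∧
      (∀ j k, j < k → k < m → s ≤ σ k * cross (p j) (p k)) ∧
      (∀ i j k, i < j → j < k → k < m → 0 < σ j * cross (p j - p i) (p k - p j)) := by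
  obtain ⟨a, g, δ, hg, hδ, hδg, ha, hsep, hc1, hc2⟩ := angles_exist m hm
  have hpi := Real.pi_pos
  have hcos : ∀ k, Real.cos (σ k * a k) = Real.cos (a k) := by
    intro k; rcases hσ k with h | h <;> simp [h]
  have hs : ∀ j k, j < k → k < m → g ≤ σ k * (σ k * a k - σ j * a j) ∧
      σ k * (σ k * a k - σ j * a j) ≤ Real.pi - g := by
    intro j k hjk hk
    have h1 := hsep j k hjk hk
    have h2 := ha j (by omega)
    have h3 := ha k hk
    rcases hσ k with h | h <;> rcases hσ j with h' | h' <;> rw [h, h'] <;>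
      constructor <;> linarith
  have hsin : ∀ k t, Real.sin (σ k * t) = σ k * Real.sin t := by
    intro k t; rcases hσ k with h | h <;> simp [h]
  obtain ⟨V, idx, h1, h2, h3, h4, h5, h6⟩ := gon_exists m (by omega)
    (fun k : Fin m => σ k * a k) g hg (by
      have key : ∀ j k : Fin m, j < k → g ≤ |σ k * a k - σ j * a j| ∧
          |σ k * a k - σ j * a j| ≤ Real.pi - g := by
        intro j k hjk
        have := hs j k hjk k.isLt
        have e : |σ k * a k - σ j * a j| = |σ k * (σ k * a k - σ j * a j)| := by
          rw [abs_mul]; rcases hσ k with h | h <;> simp [h]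
        rw [e, abs_of_pos (by linarith)]
        exact this
      intro j k hjk
      rcases lt_or_gt_of_ne hjk with h | h
      · have := key j k h
        rwa [abs_sub_comm] at this
      · exact key k j h)
  refine ⟨fun k => circ (σ k * a k), Real.sin g, δ, V, idx, hδ, hδg, h1, h2, h3, h4, h5, h6,
    fun k => Real.abs_sin_le_one _, ?_, ?_, ?_, ?_, ?_, ?_⟩
  · intro k hk
    have := ha k hk
    rw [circ_im, hcos]
    have := Real.cos_pos_of_mem_Ioo (x := a k) ⟨by linarith, by linarith⟩
    linarith
  · intro j k hjk hk
    rw [circ_im, circ_im, hcos, hcos]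
    have := Real.cos_lt_cos_of_nonneg_of_le_pi_div_two (ha j (by omega)).1 (ha k hk).2.le
      (by linarith [(hsep j k hjk hk).1])
    linarith
  · rw [circ_im, hcos]; linarith
  · rw [circ_im, hcos]; linarith
  · intro j k hjk hk
    rw [circ_cross, ← hsin]
    have := hs j k hjk hk
    exact sin_ge g _ hg this.1 this.2
  · intro i j k hij hjk hk
    have e : cross (circ (σ j * a j) - circ (σ i * a i)) (circ (σ k * a k) - circ (σ j * a j)) =
      cross (circ (σ j * a j) - circ (σ i * a i)) (circ (σ k * a k) - circ (σ i * a i)) := by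
      simp only [cross_eq, Complex.sub_re, Complex.sub_im]; ring
    simp only []
    rw [e, circ_tri]
    have q : ∀ i j, i < j → j < m → 0 < σ j * Real.sin ((σ j * a j - σ i * a i) / 2) := by
      intro i j hij hj
      rw [← hsin]
      have := hs i j hij hj
      apply Real.sin_pos_of_pos_of_lt_pi <;> linarith
    have q1 := q i j hij (by omega)
    have q2 := q j k hjk hk
    have q3 := q i k (by omega) hk
    have q4 := mul_pos q1 (mul_pos q2 q3)
    have q5 : σ k * σ k = 1 := by rcases hσ k with h | h <;> simp [h]
    have : ∀ A B C : ℝ, σ j * (4 * A * B * C) = 4 * (σ j * A * (σ k * B * (σ k * C))) := by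
      intro A B C
      linear_combination (-4 * σ j * A * B * C) * q5
    rw [this]
    linarith

lemma mem_diag (m : ℕ) (hm : 3 ≤ m) (V : ZMod (2 * m) → ℂ) (s d : ℝ) (hd : 2 * |d| < s)
    (hsym : ∀ z, V (z + (m : ZMod (2 * m))) = - V z)
    (hcr : ∀ z, s ≤ cross (V (z - 1)) (V z)) (hre : ∀ z, |(V z).re| ≤ 1) :
    (⟨0, d⟩ : ℂ) ∈ DiagGon V (m - 1) := by
  intro j
  have e : j + ((m - 1 : ℕ) : ZMod (2 * m)) = (j - 1) + (m : ZMod (2 * m)) := by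
    rw [Nat.cast_sub (by omega)]; push_cast; ring
  rw [e, hsym]
  have h1 := hcr j
  have h2 : |(V (j - 1)).re + (V j).re| ≤ 2 :=
    (abs_add_le _ _).trans (by linarith [hre (j - 1), hre j])
  have h3 : |d * ((V (j - 1)).re + (V j).re)| ≤ |d| * 2 := by
    rw [abs_mul]; exact mul_le_mul_of_nonneg_left h2 (abs_nonneg d)
  have h4 := abs_le.1 h3
  rw [cross_eq] at h1 ⊢
  simp only [Complex.sub_re, Complex.sub_im, Complex.neg_re, Complex.neg_im]
  linarith [h4.1, h4.2]

lemma stable_of (m : ℕ) (hm : 3 ≤ m) (V : ZMod (2 * m) → ℂ) (s d : ℝ) (hd0 : 0 ≤ d)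
    (hd : 2 * d < s) (hc : PosConvex V)
    (hsym : ∀ z, V (z + (m : ZMod (2 * m))) = - V z)
    (hcr : ∀ z, s ≤ cross (V (z - 1)) (V z)) (hre : ∀ z, |(V z).re| ≤ 1) :
    IsStableDGon (m + 1) V (⟨0, d⟩ : ℂ) := by
  have e : -(⟨0, d⟩ : ℂ) = ⟨0, -d⟩ := by apply Complex.ext <;> simp
  refine ⟨hc, hsym, ?_, ?_, ?_⟩
  · rcases hd0.eq_or_lt with h | h
    · right; rw [← h]; apply Complex.ext <;> simp
    · left; left; simpa using h
  · rw [e]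
    exact mem_diag m hm V s (-d) (by rwa [abs_neg, abs_of_nonneg hd0]) hsym hcr hre
  · exact mem_diag m hm V s d (by rwa [abs_of_nonneg hd0]) hsym hcr hre

lemma pert (σ s δ : ℝ) (hσ : σ = 1 ∨ σ = -1) (hδ : 0 ≤ δ) (hs : 2 * δ < s) (c x y : ℝ)
    (hc : s ≤ σ * c) (hx : |x| ≤ 1) (hy : |y| ≤ 1) : 0 < σ * (c + δ * (x + y)) := by
  have h2 : |x + y| ≤ 2 := (abs_add_le _ _).trans (by linarith)
  have h3 : |δ * (x + y)| ≤ δ * 2 := by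
    rw [abs_mul, abs_of_nonneg hδ]; exact mul_le_mul_of_nonneg_left h2 hδ
  have h4 := abs_le.1 h3
  rcases hσ with h | h <;> rw [h] at hc ⊢ <;> linarith [h4.1, h4.2]

/-- Geometric form of Proposition 5.2 (type `D_n`): every orientation (sign function `ε`)
of the type `D_n` diagram is realized by a stable `2(n-1)`-gon of type `D_n`.  Here the
increasing enumeration `Y_{-n} ≤ ⋯ ≤ Y_{-1} ≤ Y_1 ≤ ⋯ ≤ Y_n` of the `2n` marked points
is encoded by `Y 0, …, Y (2n-1)` (so `Y_{i-n} = Y i` for `0 ≤ i ≤ n-1`), the diagonals are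
`s_i = Y i − Y (i-1)` for `1 ≤ i ≤ n-1`, and `s_n` is `B₊ − Y_{-2}` or `B₊ − Y_{-1}`
according to whether `B₋ = Y_{-1}` or `B₋ = Y_{-2}`. -/
theorem typeD_realization (n : ℕ) (hn : 4 ≤ n) (ε : ℕ → ℤ)
    (hε : ∀ i, 2 ≤ i → i ≤ n → ε i = 1 ∨ ε i = -1) :
    ∃ (V : ZMod (2 * (n - 1)) → ℂ) (B : ℂ) (Y : ℕ → ℂ)
      (e : Fin (2 * n) ≃ (ZMod (2 * (n - 1)) ⊕ Fin 2)),
      IsStableDGon n V B ∧ DEnum n V B Y e ∧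
      (∀ i, 2 ≤ i → i ≤ n - 1 →
        0 < (ε i : ℝ) * cross (Y (i - 1) - Y (i - 2)) (Y i - Y (i - 1))) ∧
      ∃ sN : ℂ,
        ((-B = Y (n - 1) ∧ sN = B - Y (n - 2)) ∨
         (-B = Y (n - 2) ∧ sN = B - Y (n - 1))) ∧
        0 < (ε n : ℝ) * cross (Y (n - 2) - Y (n - 3)) sN := by
  obtain ⟨m, rfl⟩ : ∃ m, n = m + 1 := ⟨n - 1, by omega⟩
  have hm : 3 ≤ m := by omega
  simp only [Nat.add_sub_cancel]
  rw [show m + 1 - 2 = m - 1 by omega, show m + 1 - 3 = m - 2 by omega]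
  let σ0 : ℕ → ℝ := fun k => if ε (k + 1) = 1 then 1 else -1
  have hσ0 : ∀ k, σ0 k = 1 ∨ σ0 k = -1 := by
    intro k; simp only [σ0]; split_ifs <;> simp
  have hσε : ∀ k, 1 ≤ k → k ≤ m → (ε (k + 1) : ℝ) = σ0 k := by
    intro k h1 h2
    rcases hε (k + 1) (by omega) (by omega) with h | h <;> simp [σ0, h]
  by_cases hcase : σ0 m = σ0 (m - 1)
  · obtain ⟨p, s, δ, V, idx, hδ, hδs, hconv, hsym, hidx, hsurj, hcr, hre, hpre, hpneg, hpmono,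
      -, -, hK, hT⟩ := base_exists m hm σ0 hσ0
    set B : ℂ := ⟨0, 0⟩ with hB
    have hB0 : B = 0 := rfl
    set P : ℕ → ℂ := fun k => if k < m then p k else -B with hPdef
    have hPlt : ∀ k, k < m → P k = p k := fun k hk => by simp [hPdef, hk]
    have hPm : P m = 0 := by simp [hPdef, hB0]
    obtain ⟨e, he⟩ := enum_exists m hm V idx B hsym hsurj P
      (fun k => by rw [hidx, hPlt k k.isLt]) (by simp [hPdef]) id (fun i hi => ⟨hi, rfl⟩)
      (by
        intro i j hij hj
        by_cases h : j < m
        · simpa [hPlt, h, hij.trans h] using hpmono i j hij h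
        · have : j = m := by omega
          subst this
          simpa [hPlt, hPm, hij] using hpneg i hij)
      (by
        intro i hi
        by_cases h : i < m
        · left; simpa [hPlt, h] using hpneg i h
        · right
          have : i = m := by omega
          subst this
          exact hPm)
    set Y : ℕ → ℂ := fun i => if i < m + 1 then P (id i) else - P (id (2 * m + 1 - i)) with hY
    have hYlt : ∀ k, k < m → Y k = p k := fun k hk => by
      simp only [hY, show k < m + 1 by omega, if_true, id]
      exact hPlt k hk
    have hYm : Y m = 0 := by simp [hY, hPm]
    have hlast : 0 < σ0 (m - 1) * cross (p (m - 1) - p (m - 2)) (0 - p (m - 1)) := by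
      have := hK (m - 2) (m - 1) (by omega) (by omega)
      have e : cross (p (m - 1) - p (m - 2)) (0 - p (m - 1)) = cross (p (m - 2)) (p (m - 1)) := by
        simp only [cross_eq, Complex.sub_re, Complex.sub_im, Complex.zero_re, Complex.zero_im]
        ring
      rw [e]; linarith
    refine ⟨V, B, Y, e, stable_of m hm V s 0 le_rfl (by linarith) hconv hsym hcr hre, he, ?_, ?_⟩
    · intro i hi1 hi2
      obtain ⟨k, rfl⟩ : ∃ k, i = k + 2 := ⟨i - 2, by omega⟩
      rw [hσε (k + 1) (by omega) (by omega)]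
      simp only [Nat.add_sub_cancel, show k + 2 - 1 = k + 1 by omega]
      by_cases h : k + 2 < m
      · rw [hYlt _ h, hYlt (k + 1) (by omega), hYlt k (by omega)]
        exact hT k (k + 1) (k + 2) (by omega) (by omega) h
      · have : m = k + 2 := by omega
        subst this
        rw [hYm, hYlt (k + 1) (by omega), hYlt k (by omega)]
        exact hlast
    · refine ⟨B - Y (m - 1), Or.inl ⟨by rw [hYm, hB0, neg_zero], rfl⟩, ?_⟩
      rw [hσε m (by omega) le_rfl, hcase, hB0, hYlt (m - 1) (by omega), hYlt (m - 2) (by omega)]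
      exact hlast
  · have hopp : σ0 m = - σ0 (m - 1) := by
      rcases hσ0 m with h | h <;> rcases hσ0 (m - 1) with h' | h' <;> rw [h, h'] at hcase ⊢ <;>
        simp_all
    let σ : ℕ → ℝ := fun k => if k = m - 1 then σ0 m else σ0 k
    have hσ : ∀ k, σ k = 1 ∨ σ k = -1 := by
      intro k; simp only [σ]; split_ifs <;> apply hσ0
    have hσl : σ (m - 1) = σ0 m := by simp [σ]
    have hσk : ∀ k, k < m - 1 → σ k = σ0 k := fun k hk => by
      simp [σ, show k ≠ m - 1 by omega]
    obtain ⟨p, s, δ, V, idx, hδ, hδs, hconv, hsym, hidx, hsurj, hcr, hre, hpre, hpneg, hpmono,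
      hw1, hw2, hK, hT⟩ := base_exists m hm σ hσ
    set B : ℂ := ⟨0, δ⟩ with hB
    have hBre : B.re = 0 := rfl
    have hBim : B.im = δ := rfl
    set P : ℕ → ℂ := fun k => if k < m then p k else -B with hPdef
    have hPlt : ∀ k, k < m → P k = p k := fun k hk => by simp [hPdef, hk]
    have hPm : P m = -B := by simp [hPdef]
    let ρ : ℕ → ℕ := fun i => if i = m - 1 then m else if i = m then m - 1 else i
    have hρ1 : ρ (m - 1) = m := by simp [ρ]
    have hρ2 : ρ m = m - 1 := by simp [ρ]
    have hρ3 : ∀ i, i < m - 1 → ρ i = i := fun i hi => by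
      simp [ρ, show i ≠ m - 1 by omega, show i ≠ m by omega]
    have hplow : ∀ i, i < m - 1 → (p i).im < -δ := by
      intro i hi
      by_cases h : i = m - 2
      · rw [h]; exact hw2
      · exact (hpmono i (m - 2) (by omega) (by omega)).trans hw2
    obtain ⟨e, he⟩ := enum_exists m hm V idx B hsym hsurj P
      (fun k => by rw [hidx, hPlt k k.isLt]) hPm ρ
      (by
        intro i hi
        simp only [ρ]
        split_ifs <;> omega)
      (by
        intro i j hij hj
        rcases (show j < m - 1 ∨ j = m - 1 ∨ j = m by omega) with h | h | h
        · rw [hρ3 i (by omega), hρ3 j h, hPlt i (by omega), hPlt j (by omega)]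
          exact hpmono i j hij (by omega)
        · subst h
          rw [hρ3 i hij, hρ1, hPm, hPlt i (by omega), Complex.neg_im, hBim]
          exact hplow i hij
        · subst h
          rw [hρ2, hPlt (j - 1) (by omega)]
          by_cases h' : i = j - 1
          · subst h'
            rw [hρ1, hPm, Complex.neg_im, hBim]; exact hw1
          · rw [hρ3 i (by omega), hPlt i (by omega)]
            exact hpmono i (j - 1) (by omega) (by omega))
      (by
        intro i hi
        left
        rcases (show i < m - 1 ∨ i = m - 1 ∨ i = m by omega) with h | h | h
        · rw [hρ3 i h, hPlt i (by omega)]; exact hpneg i (by omega)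
        · rw [h, hρ1, hPm, Complex.neg_im, hBim]; linarith
        · rw [h, hρ2, hPlt (m - 1) (by omega)]; exact hpneg _ (by omega))
    set Y : ℕ → ℂ := fun i => if i < m + 1 then P (ρ i) else - P (ρ (2 * m + 1 - i)) with hY
    have hYlt : ∀ k, k < m - 1 → Y k = p k := fun k hk => by
      simp only [hY, show k < m + 1 by omega, if_true]
      rw [hρ3 k hk, hPlt k (by omega)]
    have hY1 : Y (m - 1) = -B := by
      simp only [hY, show m - 1 < m + 1 by omega, if_true]
      rw [hρ1, hPm]
    have hY2 : Y m = p (m - 1) := by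
      simp only [hY, show m < m + 1 by omega, if_true]
      rw [hρ2, hPlt _ (by omega)]
    have hneg : ∀ k, |-(p k).re| ≤ 1 := fun k => by rw [abs_neg]; exact hpre k
    refine ⟨V, B, Y, e, stable_of m hm V s δ hδ.le hδs hconv hsym hcr hre, he, ?_, ?_⟩
    · intro i hi1 hi2
      obtain ⟨k, rfl⟩ : ∃ k, i = k + 2 := ⟨i - 2, by omega⟩
      rw [hσε (k + 1) (by omega) (by omega)]
      simp only [Nat.add_sub_cancel, show k + 2 - 1 = k + 1 by omega]
      rcases (show k + 2 < m - 1 ∨ k + 2 = m - 1 ∨ k + 2 = m by omega) with h | h | h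
      · rw [hYlt _ h, hYlt (k + 1) (by omega), hYlt k (by omega), ← hσk (k + 1) (by omega)]
        exact hT k (k + 1) (k + 2) (by omega) (by omega) (by omega)
      · rw [h, hY1, hYlt (k + 1) (by omega), hYlt k (by omega), ← hσk (k + 1) (by omega)]
        have := pert (σ (k + 1)) s δ (hσ _) hδ.le hδs _ _ _
          (hK k (k + 1) (by omega) (by omega)) (hneg (k + 1)) (hpre k)
        convert this using 2
        simp only [cross_eq, Complex.sub_re, Complex.sub_im, Complex.neg_re, Complex.neg_im,
          hBre, hBim]
        ring
      · have hk1 : k + 1 = m - 1 := by omega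
        have e0 : σ0 (k + 1) = - σ (m - 1) := by rw [hσl, hopp, hk1, neg_neg]
        rw [e0, h, hk1, hY1, hY2, hYlt k (by omega)]
        have := pert (σ (m - 1)) s δ (hσ _) hδ.le hδs _ _ _
          (hK k (m - 1) (by omega) (by omega)) (hneg (m - 1)) (hpre k)
        convert this using 1
        simp only [cross_eq, Complex.sub_re, Complex.sub_im, Complex.neg_re, Complex.neg_im,
          hBre, hBim]
        ring
    · refine ⟨B - Y m, Or.inr ⟨hY1.symm, rfl⟩, ?_⟩
      rw [hσε m (by omega) le_rfl, ← hσl, hY1, hY2, hYlt (m - 2) (by omega)]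
      have := pert (σ (m - 1)) s δ (hσ _) hδ.le hδs _ _ _
          (hK (m - 2) (m - 1) (by omega) (by omega)) (hneg (m - 1)) (hneg (m - 2))
      convert this using 2
      simp only [cross_eq, Complex.sub_re, Complex.sub_im, Complex.neg_re, Complex.neg_im,
          hBre, hBim]
      ring
end
end

section
/- (Remark 4.6.) Let (V₀, …, V₁₁) be a stable 12-gon of type E6 with inner points W_j, and suppose (after cyclic relabeling) that each of V₁, V₂, V₃ is smaller, in the order on ℂ, than every other point of {V_j} ∪ {W_j}. Then the three largest of the 24 points {V_j} ∪ {W_j} are exactly V₇, V₈, V₉; that is, each of V₇, V₈, V₉ is greater than every W_k (k ∈ ℤ/12) and than every V_i with i ∉ {7, 8, 9}. -/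
noncomputable section

/-- A 12-gon of type E6: the edge vectors satisfy the two families of linear relations. -/
def IsE6Gon (V : ZMod 12 → ℂ) : Prop :=
  ∀ j : ZMod 12,
    zEdge V j + zEdge V (j + 4) + zEdge V (j + 8) = 0 ∧
    zEdge V j - zEdge V (j - 3) + zEdge V (j - 6) - zEdge V (j - 9) = 0

/-- The inner points `W j` of a 12-gon of type E6. -/
def WE6 (V : ZMod 12 → ℂ) (j : ZMod 12) : ℂ := V j + zEdge V (j + 4)

/-- A stable 12-gon of type E6. -/
def IsStableE6Gon (V : ZMod 12 → ℂ) : Prop :=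
  IsE6Gon V ∧ PosConvex V ∧ ∀ j : ZMod 12, WE6 V j ∈ DiagGon V 3

def ff (ε : ℝ) (a : ℂ) : ℝ := a.im + ε * a.re

lemma ff_sub (ε : ℝ) (a b : ℂ) : ff ε (a - b) = ff ε a - ff ε b := by
  simp [ff]; ring

lemma cross_id (ε : ℝ) (p q w : ℂ) :
    cross p q * ff ε w = - cross q w * ff ε p + cross p w * ff ε q := by
  simp [ff, cross]; ring

lemma locmin (V : ZMod 12 → ℂ) (hC : PosConvex V) (ε : ℝ) (j i : ZMod 12)
    (h1 : i ≠ j - 1) (h2 : i ≠ j) (h3 : i ≠ j + 1) (h : ff ε (V i) < ff ε (V j)) :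
    ff ε (V (j - 1)) < ff ε (V j) ∨ ff ε (V (j + 1)) < ff ε (V j) := by
  by_contra! hcon
  obtain ⟨c1, c2⟩ := hcon
  have e1 := hC j i h1 h2
  have e2 := hC (j + 1) i (by simpa using h2) h3
  have e3 := hC j (j + 1) ((by decide : ∀ j : ZMod 12, j + 1 ≠ j - 1) j)
    ((by decide : ∀ j : ZMod 12, j + 1 ≠ j) j)
  rw [show j + 1 - 1 = j by ring] at e2
  have k1 : cross (V j - V (j - 1)) (V i - V j) = cross (V j - V (j - 1)) (V i - V (j - 1)) := by
    simp [cross]; ring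
  have k2 : cross (V j - V (j - 1)) (V (j + 1) - V j)
      = cross (V j - V (j - 1)) (V (j + 1) - V (j - 1)) := by
    simp [cross]; ring
  have := cross_id ε (V j - V (j - 1)) (V (j + 1) - V j) (V i - V j)
  rw [k1, k2] at this
  simp only [ff_sub] at this
  nlinarith [mul_pos e3 (sub_pos.2 h), mul_nonneg e2.le (sub_nonneg.2 c1),
    mul_nonneg e1.le (sub_nonneg.2 c2)]

lemma e6_par (V : ZMod 12 → ℂ) (hE : IsE6Gon V) :
    V 7 - V 10 = V 4 - V 1 ∧ V 8 - V 11 = V 5 - V 2 ∧ V 9 - V 0 = V 6 - V 3 := by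
  have a0 : (V 0 - V 11) + (V 4 - V 3) + (V 8 - V 7) = 0 := (hE 0).1
  have a1 : (V 1 - V 0) + (V 5 - V 4) + (V 9 - V 8) = 0 := (hE 1).1
  have a2 : (V 2 - V 1) + (V 6 - V 5) + (V 10 - V 9) = 0 := (hE 2).1
  have a3 : (V 3 - V 2) + (V 7 - V 6) + (V 11 - V 10) = 0 := (hE 3).1
  have b0 : (V 0 - V 11) - (V 9 - V 8) + (V 6 - V 5) - (V 3 - V 2) = 0 := (hE 0).2
  have b1 : (V 1 - V 0) - (V 10 - V 9) + (V 7 - V 6) - (V 4 - V 3) = 0 := (hE 1).2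
  have b2 : (V 2 - V 1) - (V 11 - V 10) + (V 8 - V 7) - (V 5 - V 4) = 0 := (hE 2).2
  have ra0 := congrArg Complex.re a0
  have ia0 := congrArg Complex.im a0
  have ra1 := congrArg Complex.re a1
  have ia1 := congrArg Complex.im a1
  have ra2 := congrArg Complex.re a2
  have ia2 := congrArg Complex.im a2
  have ra3 := congrArg Complex.re a3
  have ia3 := congrArg Complex.im a3
  have rb0 := congrArg Complex.re b0
  have ib0 := congrArg Complex.im b0
  have rb1 := congrArg Complex.re b1
  have ib1 := congrArg Complex.im b1
  have rb2 := congrArg Complex.re b2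
  have ib2 := congrArg Complex.im b2
  simp only [Complex.add_re, Complex.sub_re, Complex.add_im, Complex.sub_im, Complex.zero_re,
    Complex.zero_im] at *
  refine ⟨?_, ?_, ?_⟩ <;> apply Complex.ext <;>
    simp only [Complex.sub_re, Complex.sub_im] <;> linarith

lemma inner_lt (ε : ℝ) (A B C D W : ℂ) (hp : C - D = B - A)
    (h1 : 0 < cross (B - A) (W - A)) (h2 : 0 < cross (C - B) (W - B))
    (h3 : 0 < cross (D - C) (W - C))
    (f1 : ff ε B < ff ε C) (f2 : ff ε D < ff ε C) : ff ε W < ff ε C := by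
  have hD : D = C - (B - A) := by rw [← hp]; ring
  subst hD
  have k : cross (C - B) (C - (B - A) - C) = cross (B - A) (W - A) + cross (C - (B - A) - C) (W - C) := by
    simp [cross]; ring
  have k2 : cross (C - B) (W - C) = cross (C - B) (W - B) := by
    simp [cross]; ring
  have := cross_id ε (C - B) (C - (B - A) - C) (W - C)
  rw [k, k2] at this
  rw [ff_sub ε W C, ff_sub ε C B, ff_sub ε (C - (B - A)) C] at this
  by_contra! hc
  nlinarith [mul_nonneg (add_pos h1 h3).le (sub_nonneg.2 hc), mul_pos h3 (sub_pos.2 f1),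
    mul_pos h2 (sub_pos.2 f2)]

lemma lin (y0 y1 y2 y3 y4 y5 y6 y7 y8 y9 y10 y11 : ℝ)
    (m5 : y4 < y5 ∨ y6 < y5)
    (m6 : y5 < y6 ∨ y7 < y6)
    (m7 : y6 < y7 ∨ y8 < y7)
    (m8 : y7 < y8 ∨ y9 < y8)
    (m9 : y8 < y9 ∨ y10 < y9)
    (m10 : y9 < y10 ∨ y11 < y10)
    (m11 : y10 < y11 ∨ y0 < y11)
    (q7 : y7 - y10 = y4 - y1)
    (q8 : y8 - y11 = y5 - y2)
    (q9 : y9 - y0 = y6 - y3)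
    (s14 : y1 < y4)
    (s25 : y2 < y5)
    (s36 : y3 < y6)
    (s34 : y3 < y4)
    (s10 : y1 < y0)
    (s30 : y3 < y0)
    (s211 : y2 < y11) :
    y6 < y7 ∧ y10 < y9 ∧ y5 < y6 ∧ y4 < y5 ∧ y11 < y10 ∧ y0 < y11 ∧ y6 < y8 ∧ y10 < y8 := by
  have g6_7 : y6 < y7 := by
    by_contra! hc
    grind
  have g10_9 : y10 < y9 := by
    by_contra! hc
    grind
  have g5_6 : y5 < y6 := by
    by_contra! hc
    grind
  have g4_5 : y4 < y5 := by
    by_contra! hc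
    grind
  have g11_10 : y11 < y10 := by
    by_contra! hc
    grind
  have g0_11 : y0 < y11 := by
    by_contra! hc
    grind
  have g6_8 : y6 < y8 := by
    by_contra! hc
    grind
  have g10_8 : y10 < y8 := by
    by_contra! hc
    grind
  exact ⟨g6_7, g10_9, g5_6, g4_5, g11_10, g0_11, g6_8, g10_8⟩

lemma core (V : ZMod 12 → ℂ) (hV : IsStableE6Gon V) (ε : ℝ)
    (hs : ∀ t : ZMod 12, t ∈ ({1, 2, 3} : Set (ZMod 12)) →
      ∀ i : ZMod 12, i ∉ ({1, 2, 3} : Set (ZMod 12)) → ff ε (V t) < ff ε (V i)) :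
    ∀ t : ZMod 12, t ∈ ({7, 8, 9} : Set (ZMod 12)) →
      (∀ k : ZMod 12, ff ε (WE6 V k) < ff ε (V t)) ∧
      (∀ i : ZMod 12, i ∉ ({7, 8, 9} : Set (ZMod 12)) → ff ε (V i) < ff ε (V t)) := by
  obtain ⟨hE, hC, hD⟩ := hV
  obtain ⟨p7, p8, p9⟩ := e6_par V hE
  have m5 := locmin V hC ε 5 2 (by decide) (by decide) (by decide) (hs 2 (by simp) 5 (by decide))
  rw [show (5 - 1 : ZMod 12) = 4 from rfl, show (5 + 1 : ZMod 12) = 6 from rfl] at m5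
  have m6 := locmin V hC ε 6 2 (by decide) (by decide) (by decide) (hs 2 (by simp) 6 (by decide))
  rw [show (6 - 1 : ZMod 12) = 5 from rfl, show (6 + 1 : ZMod 12) = 7 from rfl] at m6
  have m7 := locmin V hC ε 7 2 (by decide) (by decide) (by decide) (hs 2 (by simp) 7 (by decide))
  rw [show (7 - 1 : ZMod 12) = 6 from rfl, show (7 + 1 : ZMod 12) = 8 from rfl] at m7
  have m8 := locmin V hC ε 8 2 (by decide) (by decide) (by decide) (hs 2 (by simp) 8 (by decide))
  rw [show (8 - 1 : ZMod 12) = 7 from rfl, show (8 + 1 : ZMod 12) = 9 from rfl] at m8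
  have m9 := locmin V hC ε 9 2 (by decide) (by decide) (by decide) (hs 2 (by simp) 9 (by decide))
  rw [show (9 - 1 : ZMod 12) = 8 from rfl, show (9 + 1 : ZMod 12) = 10 from rfl] at m9
  have m10 := locmin V hC ε 10 2 (by decide) (by decide) (by decide) (hs 2 (by simp) 10 (by decide))
  rw [show (10 - 1 : ZMod 12) = 9 from rfl, show (10 + 1 : ZMod 12) = 11 from rfl] at m10
  have m11 := locmin V hC ε 11 2 (by decide) (by decide) (by decide) (hs 2 (by simp) 11 (by decide))
  rw [show (11 - 1 : ZMod 12) = 10 from rfl, show (11 + 1 : ZMod 12) = 12 from rfl] at m11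
  have q7 := congrArg (ff ε) p7
  have q8 := congrArg (ff ε) p8
  have q9 := congrArg (ff ε) p9
  simp only [ff_sub] at q7 q8 q9
  have s1 := hs 1 (by simp)
  have s2 := hs 2 (by simp)
  have s3 := hs 3 (by simp)
  have s14 := s1 4 (by decide)
  have s25 := s2 5 (by decide)
  have s36 := s3 6 (by decide)
  have s34 := s3 4 (by decide)
  have s10 := s1 0 (by decide)
  have s30 := s3 0 (by decide)
  have s211 := s2 11 (by decide)
  have n12 : (12 : ZMod 12) = 0 := rfl
  rw [n12] at m11
  obtain ⟨g67, g109, g56, g45, g1110, g011, g68, g108⟩ := lin _ _ _ _ _ _ _ _ _ _ _ _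
    m5 m6 m7 m8 m9 m10 m11 q7 q8 q9 s14 s25 s36 s34 s10 s30 s211
  have g69 : ff ε (V 6) < ff ε (V 9) := by
    linarith
  have g107 : ff ε (V 10) < ff ε (V 7) := by
    linarith
  have cases12 : ∀ i : ZMod 12, i ∉ ({7, 8, 9} : Set (ZMod 12)) →
      i = 0 ∨ i = 1 ∨ i = 2 ∨ i = 3 ∨ i = 4 ∨ i = 5 ∨ i = 6 ∨ i = 10 ∨ i = 11 := by
    decide
  have s26 := s2 6 (by decide)
  have s16 := s1 6 (by decide)
  have key : ∀ t : ZMod 12, t ∈ ({7, 8, 9} : Set (ZMod 12)) →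
      ∀ i : ZMod 12, i ∉ ({7, 8, 9} : Set (ZMod 12)) → ff ε (V i) < ff ε (V t) := by
    intro t ht i hi
    rcases ht with rfl | rfl | rfl <;>
    rcases cases12 i hi with rfl | rfl | rfl | rfl | rfl | rfl | rfl | rfl | rfl <;> linarith
  intro t ht
  refine ⟨fun k => ?_, key t ht⟩
  have d := hD k
  rcases ht with rfl | rfl | rfl
  · exact inner_lt ε (V 1) (V 4) (V 7) (V 10) _ p7 (d 1) (d 4) (d 7)
      (by linarith) (by linarith)
  · exact inner_lt ε (V 2) (V 5) (V 8) (V 11) _ p8 (d 2) (d 5) (d 8)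
      (by linarith) (by linarith)
  · exact inner_lt ε (V 3) (V 6) (V 9) (V 0) _ p9 (d 3) (d 6) (d 9)
      (by linarith) (by linarith)

lemma ev_lt (a b : ℂ) (h : cLt a b) : ∀ᶠ ε in nhdsWithin (0 : ℝ) (Set.Ioi 0), ff ε a < ff ε b := by
  rcases h with h | ⟨h, h'⟩
  · have c : Continuous fun ε : ℝ => ff ε b - ff ε a := by unfold ff; fun_prop
    have := c.tendsto 0 |>.eventually (lt_mem_nhds (a := 0) (by simpa [ff] using h))
    filter_upwards [nhdsWithin_le_nhds this] with ε hε
    linarith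
  · filter_upwards [self_mem_nhdsWithin] with ε hε
    have : (0 : ℝ) < ε := hε
    unfold ff
    nlinarith [mul_pos this (sub_pos.2 h')]

lemma ev_le (a b : ℂ) (h : ¬ cLt a b) :
    ∀ᶠ ε in nhdsWithin (0 : ℝ) (Set.Ioi 0), ff ε b ≤ ff ε a := by
  by_cases e : a = b
  · simp [e]
  · refine (ev_lt b a ?_).mono fun _ h => h.le
    unfold cLt at *
    push Not at h
    rcases h.1.lt_or_eq with h1 | h1
    · exact Or.inl h1
    · refine Or.inr ⟨h1, (h.2 h1.symm).lt_of_ne fun h2 => e (Complex.ext h2.symm h1.symm)⟩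

/-- (Remark 4.6.) In a stable 12-gon of type `E6` in which `V 1, V 2, V 3` are the three
smallest of the 24 points `{V j} ∪ {W j}`, the three largest points are exactly
`V 7, V 8, V 9`. -/
theorem e6_three_largest (V : ZMod 12 → ℂ) (hV : IsStableE6Gon V)
    (hsmall : ∀ t : ZMod 12, t ∈ ({1, 2, 3} : Set (ZMod 12)) →
      (∀ k : ZMod 12, cLt (V t) (WE6 V k)) ∧
      (∀ i : ZMod 12, i ∉ ({1, 2, 3} : Set (ZMod 12)) → cLt (V t) (V i))) :
    ∀ t : ZMod 12, t ∈ ({7, 8, 9} : Set (ZMod 12)) →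
      (∀ k : ZMod 12, cLt (WE6 V k) (V t)) ∧
      (∀ i : ZMod 12, i ∉ ({7, 8, 9} : Set (ZMod 12)) → cLt (V i) (V t)) := by
  have hs : ∀ᶠ ε in nhdsWithin (0 : ℝ) (Set.Ioi 0), ∀ t : ZMod 12,
      t ∈ ({1, 2, 3} : Set (ZMod 12)) →
      ∀ i : ZMod 12, i ∉ ({1, 2, 3} : Set (ZMod 12)) → ff ε (V t) < ff ε (V i) := by
    have : Finite (ZMod 12) := inferInstanceAs (Finite (Fin 12))
    refine Filter.eventually_all.2 fun t => ?_
    by_cases ht : t ∈ ({1, 2, 3} : Set (ZMod 12))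
    · refine Filter.Eventually.mono (Filter.eventually_all.2 fun i => ?_) (fun _ h _ => h)
      by_cases hi : i ∈ ({1, 2, 3} : Set (ZMod 12))
      · exact Filter.Eventually.of_forall fun _ h => absurd hi h
      · exact (ev_lt _ _ ((hsmall t ht).2 i hi)).mono fun _ h _ => h
    · exact Filter.Eventually.of_forall fun _ h => absurd h ht
  intro t ht
  constructor
  · intro k
    by_contra hc
    obtain ⟨ε, h1, h2⟩ := (hs.and (ev_le _ _ hc)).exists
    exact absurd ((core V hV ε h1 t ht).1 k) (not_lt.2 h2)
  · intro i hi
    by_contra hc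
    obtain ⟨ε, h1, h2⟩ := (hs.and (ev_le _ _ hc)).exists
    exact absurd ((core V hV ε h1 t ht).2 i hi) (not_lt.2 h2)
end
end
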